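/- (Consensus theorem) There exists a constant c such that for every n and every subset S of the torus (Z/nZ)^2, the iterate (R^+)^{⌈cn⌉}(S) is either the empty set or the full torus. -/

import Mathlib

open Set

abbrev Pt := ℤ × ℤ

/-- Adjacency in the graph `G`: neighbor increments
`(0,1), (0,-1), (1,0), (-1,0), (-1,1), (1,-1)`. -/
def adjG (p q : Pt) : Prop :=
  q - p ∈ ({(0,1), (0,-1), (1,0), (-1,0), (-1,1), (1,-1)} : Set Pt)

/-- Reachability within a set `S` along edges of `G`. -/
def ReachIn (S : Set Pt) (p q : Pt) : Prop :=
  Relation.ReflTransGen (fun a b => a ∈ S ∧ b ∈ S ∧ adjG a b) p q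

/-- `S` is connected in the graph `G`. -/
def ConnectedIn (S : Set Pt) : Prop :=
  ∀ p ∈ S, ∀ q ∈ S, ReachIn S p q

/-- The tile with center `p`. -/
def tile (p : Pt) : Set Pt := {p, p + (1, 0), p + (0, 1)}

/-- Inflation operation `Q`. -/
def QOp (S : Set Pt) : Set Pt := ⋃ a ∈ S, tile a

/-- Toom's rule `R`: majority of self, north, east. -/
def ROp (S : Set Pt) : Set Pt := {p | 2 ≤ (S ∩ tile p).ncard}

/-- The biased Toom rule `R⁺ = Q ∘ R ∘ R`. -/
def RPlus (S : Set Pt) : Set Pt := QOp (ROp (ROp S))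

/-- The torus `(ℤ/nℤ)²`. -/
abbrev Tor (n : ℕ) := ZMod n × ZMod n

def adjT {n : ℕ} (p q : Tor n) : Prop :=
  q - p ∈ ({(0,1), (0,-1), (1,0), (-1,0), (-1,1), (1,-1)} : Set (Tor n))

def tileT {n : ℕ} (p : Tor n) : Set (Tor n) := {p, p + (1, 0), p + (0, 1)}

def QOpT {n : ℕ} (S : Set (Tor n)) : Set (Tor n) := ⋃ a ∈ S, tileT a

def ROpT {n : ℕ} (S : Set (Tor n)) : Set (Tor n) := {p | 2 ≤ (S ∩ tileT p).ncard}

def RPlusT {n : ℕ} (S : Set (Tor n)) : Set (Tor n) := QOpT (ROpT (ROpT S))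

def ReachInT {n : ℕ} (S : Set (Tor n)) (p q : Tor n) : Prop :=
  Relation.ReflTransGen (fun a b => a ∈ S ∧ b ∈ S ∧ adjT a b) p q

/-- The number of connected components of `S`. -/
noncomputable def compCount {n : ℕ} (S : Set (Tor n)) : ℕ :=
  Nat.card (Quot (fun a b : S => ReachInT S a.1 b.1))

/-- The connected component of `x` in `S`. -/
def componentT {n : ℕ} (S : Set (Tor n)) (x : Tor n) : Set (Tor n) :=
  {y ∈ S | ReachInT S x y}

def torProj (n : ℕ) (p : Pt) : Tor n := ((p.1 : ZMod n), (p.2 : ZMod n))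

/-- `A` is simple: it lifts isomorphically (as a subgraph) to a subset of `ℤ²`. -/
def SimpleSet {n : ℕ} (A : Set (Tor n)) : Prop :=
  ∃ B : Set Pt, Set.BijOn (torProj n) B A ∧
    ∀ a ∈ B, ∀ b ∈ B, (adjT (torProj n a) (torProj n b) ↔ adjG a b)

namespace Toom

section Generic

variable {G : Type*} [AddCommGroup G] (e f : G)

/-- `a` lies in the tile with center `p`. -/
def TT (p a : G) : Prop := a = p ∨ a = p + e ∨ a = p + f

def Ad (a b : G) : Prop := ∃ p, TT e f p a ∧ TT e f p b

def RR (S : Set G) : Set G :=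
  {p | (p ∈ S ∧ p + e ∈ S) ∨ (p ∈ S ∧ p + f ∈ S) ∨ (p + e ∈ S ∧ p + f ∈ S)}

def QQ (S : Set G) : Set G := {p | ∃ a ∈ S, TT e f a p}

def PP (S : Set G) : Set G := QQ e f (RR e f (RR e f S))

def Stp (S : Set G) (a b : G) : Prop := a ∈ S ∧ b ∈ S ∧ Ad e f a b

def Lk (S : Set G) (a b : G) : Prop := Relation.ReflTransGen (Stp e f S) a b

def Conn (S : Set G) : Prop := ∀ a ∈ S, ∀ b ∈ S, Lk e f S a b

def Iso (A X : Set G) : Prop := A ⊆ X ∧ ∀ a ∈ A, ∀ b ∈ X, Ad e f a b → b ∈ A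

variable {e f}

theorem Ad.symm {a b : G} (h : Ad e f a b) : Ad e f b a := by
  obtain ⟨p, h1, h2⟩ := h
  exact ⟨p, h2, h1⟩

theorem Stp.symm {S : Set G} {a b : G} (h : Stp e f S a b) : Stp e f S b a :=
  ⟨h.2.1, h.1, h.2.2.symm⟩

theorem Lk.symm {S : Set G} {a b : G} (h : Lk e f S a b) : Lk e f S b a := by
  induction h with
  | refl => exact Relation.ReflTransGen.refl
  | tail _ h2 ih => exact Relation.ReflTransGen.head h2.symm ih

theorem Lk.trans {S : Set G} {a b c : G} (h : Lk e f S a b) (h' : Lk e f S b c) :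
    Lk e f S a c := Relation.ReflTransGen.trans h h'

theorem Lk.single {S : Set G} {a b : G} (h : Stp e f S a b) : Lk e f S a b :=
  Relation.ReflTransGen.single h

theorem Lk.mono {S S' : Set G} (hS : S ⊆ S') {a b : G} (h : Lk e f S a b) : Lk e f S' a b :=
  by
  induction h with
  | refl => exact Relation.ReflTransGen.refl
  | tail _ h2 ih => exact Relation.ReflTransGen.tail ih ⟨hS h2.1, hS h2.2.1, h2.2.2⟩

theorem mem_RR {S : Set G} {p a b : G} (ha : a ∈ S) (hb : b ∈ S) (hab : a ≠ b)
    (h1 : TT e f p a) (h2 : TT e f p b) : p ∈ RR e f S := by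
  rcases h1 with rfl | rfl | rfl <;> rcases h2 with rfl | rfl | rfl <;>
    simp_all [RR]

theorem exists_of_mem_RR {S : Set G} {p : G} (h : p ∈ RR e f S) :
    ∃ a ∈ S, TT e f p a := by
  rcases h with h | h | h
  · exact ⟨_, h.1, Or.inl rfl⟩
  · exact ⟨_, h.1, Or.inl rfl⟩
  · exact ⟨_, h.1, Or.inr (Or.inl rfl)⟩

theorem ad_centers {p q a : G} (h1 : TT e f p a) (h2 : TT e f q a) : Ad e f p q := by
  have hp : p = a ∨ p = a - e ∨ p = a - f := by
    rcases h1 with rfl | rfl | rfl <;> simp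
  have hq : q = a ∨ q = a - e ∨ q = a - f := by
    rcases h2 with rfl | rfl | rfl <;> simp
  clear h1 h2
  rcases hp with rfl | rfl | rfl <;> rcases hq with rfl | rfl | rfl
  · exact ⟨_, Or.inl rfl, Or.inl rfl⟩
  · exact ⟨p - e, by simp [TT], by simp [TT]⟩
  · exact ⟨p - f, by simp [TT], by simp [TT]⟩
  · exact ⟨q - e, by simp [TT], by simp [TT]⟩
  · exact ⟨_, Or.inl rfl, Or.inl rfl⟩
  · exact ⟨a - e - f, Or.inr (Or.inr (by abel)), Or.inr (Or.inl (by abel))⟩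
  · exact ⟨q - f, by simp [TT], by simp [TT]⟩
  · exact ⟨a - e - f, Or.inr (Or.inl (by abel)), Or.inr (Or.inr (by abel))⟩
  · exact ⟨_, Or.inl rfl, Or.inl rfl⟩

theorem RR_mono {S S' : Set G} (h : S ⊆ S') : RR e f S ⊆ RR e f S' := by
  intro p hp
  rcases hp with hp | hp | hp
  · exact Or.inl ⟨h hp.1, h hp.2⟩
  · exact Or.inr (Or.inl ⟨h hp.1, h hp.2⟩)
  · exact Or.inr (Or.inr ⟨h hp.1, h hp.2⟩)

theorem QQ_mono {S S' : Set G} (h : S ⊆ S') : QQ e f S ⊆ QQ e f S' := by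
  rintro p ⟨a, ha, hp⟩
  exact ⟨a, h ha, hp⟩

theorem PP_mono {S S' : Set G} (h : S ⊆ S') : PP e f S ⊆ PP e f S' :=
  QQ_mono (RR_mono (RR_mono h))

theorem iter_mono {F : Set G → Set G} (hF : ∀ S S', S ⊆ S' → F S ⊆ F S') (k : ℕ)
    {S S' : Set G} (h : S ⊆ S') : F^[k] S ⊆ F^[k] S' := by
  induction k generalizing S S' with
  | zero => exact h
  | succ k ih => exact ih (hF _ _ h)

theorem RR_iter_mono (k : ℕ) {S S' : Set G} (h : S ⊆ S') : (RR e f)^[k] S ⊆ (RR e f)^[k] S' :=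
  iter_mono (fun _ _ h => RR_mono h) k h

theorem QQ_iter_mono (k : ℕ) {S S' : Set G} (h : S ⊆ S') : (QQ e f)^[k] S ⊆ (QQ e f)^[k] S' :=
  iter_mono (fun _ _ h => QQ_mono h) k h

theorem PP_iter_mono (k : ℕ) {S S' : Set G} (h : S ⊆ S') : (PP e f)^[k] S ⊆ (PP e f)^[k] S' :=
  iter_mono (fun _ _ h => PP_mono h) k h

theorem RR_empty : RR e f (∅ : Set G) = ∅ := by ext; simp [RR]
theorem QQ_empty : QQ e f (∅ : Set G) = ∅ := by ext; simp [QQ]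
theorem PP_empty : PP e f (∅ : Set G) = ∅ := by simp [PP, RR_empty, QQ_empty]

theorem QR_sub_RQ (S : Set G) : QQ e f (RR e f S) ⊆ RR e f (QQ e f S) := by
  have key : ∀ a b : G, a ∈ S → TT e f a b → b ∈ QQ e f S := fun a b ha h => ⟨a, ha, h⟩
  have k0 : ∀ a, a ∈ S → a ∈ QQ e f S := fun a ha => key a a ha (Or.inl rfl)
  have k1 : ∀ a, a ∈ S → a + e ∈ QQ e f S := fun a ha => key a _ ha (Or.inr (Or.inl rfl))
  have k2 : ∀ a, a ∈ S → a + f ∈ QQ e f S := fun a ha => key a _ ha (Or.inr (Or.inr rfl))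
  rintro p ⟨q, hq, hp⟩
  have hc : q + f + e = q + e + f := by abel
  have a0 := k0 q
  have a1 := k1 q
  have a2 := k2 q
  have b0 := k0 (q + e)
  have b1 := k1 (q + e)
  have b2 := k2 (q + e)
  have c0 := k0 (q + f)
  have c1 := k1 (q + f)
  have c2 := k2 (q + f)
  simp only [RR, Set.mem_ofPred_eq] at hq ⊢
  clear k0 k1 k2 key
  rw [hc] at c1
  rcases hp with rfl | rfl | rfl <;> try rw [hc]
  all_goals grind

theorem QR_iter_sub (k : ℕ) (S : Set G) : QQ e f ((RR e f)^[k] S) ⊆ (RR e f)^[k] (QQ e f S) := by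
  induction k generalizing S with
  | zero => exact subset_rfl
  | succ k ih =>
    rw [Function.iterate_succ_apply, Function.iterate_succ_apply]
    exact (ih _).trans (RR_iter_mono k (QR_sub_RQ S))

theorem fat (i : ℕ) (S : Set G) : (QQ e f)^[i] ((RR e f)^[2 * i] S) ⊆ (PP e f)^[i] S := by
  induction i generalizing S with
  | zero => exact subset_rfl
  | succ i ih =>
    have h1 : (RR e f)^[2 * (i + 1)] S = (RR e f)^[2 * i] (RR e f (RR e f S)) := by
      rw [show 2 * (i + 1) = 2 * i + 1 + 1 by ring, Function.iterate_succ_apply,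
        Function.iterate_succ_apply]
    rw [h1, Function.iterate_succ_apply, Function.iterate_succ_apply]
    exact (QQ_iter_mono i (QR_iter_sub _ _)).trans (ih _)

theorem conn_RR {S : Set G} (h : Conn e f S) : Conn e f (RR e f S) := by
  have key : ∀ a b, Lk e f S a b → ∀ p ∈ RR e f S, ∀ q ∈ RR e f S, TT e f p a → TT e f q b →
      Lk e f (RR e f S) p q := by
    intro a b hab
    induction hab with
    | refl => exact fun p hp q hq h1 h2 => Lk.single ⟨hp, hq, ad_centers h1 h2⟩
    | @tail c b _ hcb ih =>
      intro p hp q hq h1 h2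
      by_cases hc : c = b
      · subst hc; exact ih p hp q hq h1 h2
      · obtain ⟨hcS, hbS, m, hmc, hmb⟩ := hcb
        have hm : m ∈ RR e f S := mem_RR hcS hbS hc hmc hmb
        exact (ih p hp m hm h1 hmc).trans (Lk.single ⟨hm, hq, ad_centers hmb h2⟩)
  intro p hp q hq
  obtain ⟨a, ha, hpa⟩ := exists_of_mem_RR hp
  obtain ⟨b, hb, hqb⟩ := exists_of_mem_RR hq
  exact key a b (h a ha b hb) p hp q hq hpa hqb

theorem sub_QQ (S : Set G) : S ⊆ QQ e f S := fun a ha => ⟨a, ha, Or.inl rfl⟩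

theorem conn_QQ {S : Set G} (h : Conn e f S) : Conn e f (QQ e f S) := by
  rintro p ⟨a, ha, hp⟩ q ⟨b, hb, hq⟩
  have h1 : Lk e f (QQ e f S) a p := Lk.single ⟨sub_QQ S ha, ⟨a, ha, hp⟩, a, Or.inl rfl, hp⟩
  have h2 : Lk e f (QQ e f S) b q := Lk.single ⟨sub_QQ S hb, ⟨b, hb, hq⟩, b, Or.inl rfl, hq⟩
  exact h1.symm.trans (((h a ha b hb).mono (sub_QQ S)).trans h2)

theorem conn_PP {S : Set G} (h : Conn e f S) : Conn e f (PP e f S) :=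
  conn_QQ (conn_RR (conn_RR h))

theorem conn_PP_iter (k : ℕ) {S : Set G} (h : Conn e f S) : Conn e f ((PP e f)^[k] S) := by
  induction k generalizing S with
  | zero => exact h
  | succ k ih => exact ih (conn_PP h)

theorem conn_union {A B : Set G} (hA : Conn e f A) (hB : Conn e f B) {x : G} (hxA : x ∈ A)
    (hxB : x ∈ B) : Conn e f (A ∪ B) := by
  have key : ∀ y ∈ A ∪ B, Lk e f (A ∪ B) x y := by
    rintro y (hy | hy)
    · exact (hA x hxA y hy).mono Set.subset_union_left
    · exact (hB x hxB y hy).mono Set.subset_union_right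
  intro y hy z hz
  exact (key y hy).symm.trans (key z hz)

theorem Iso.RR {A X : Set G} (h : Iso e f A X) : Iso e f (RR e f A) (RR e f X) := by
  refine ⟨RR_mono h.1, ?_⟩
  rintro p hp q hq ⟨m, hmp, hmq⟩
  have key : ∀ m a b, TT e f m a → TT e f m b → a ∈ A → b ∈ X → b ∈ A :=
    fun m a b h1 h2 ha hb => h.2 a ha b hb ⟨m, h1, h2⟩
  have t0 : ∀ m, TT e f m m := fun m => Or.inl rfl
  have t1 : ∀ m, TT e f m (m + e) := fun m => Or.inr (Or.inl rfl)
  have t2 : ∀ m, TT e f m (m + f) := fun m => Or.inr (Or.inr rfl)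
  have tl : ∀ m, ((m ∈ A ∨ m + e ∈ A ∨ m + f ∈ A) →
      ((m ∈ X → m ∈ A) ∧ (m + e ∈ X → m + e ∈ A) ∧ (m + f ∈ X → m + f ∈ A))) := by
    rintro m (hm | hm | hm)
    · exact ⟨fun _ => hm, key m _ _ (t0 m) (t1 m) hm, key m _ _ (t0 m) (t2 m) hm⟩
    · exact ⟨key m _ _ (t1 m) (t0 m) hm, fun _ => hm, key m _ _ (t1 m) (t2 m) hm⟩
    · exact ⟨key m _ _ (t2 m) (t0 m) hm, key m _ _ (t2 m) (t1 m) hm, fun _ => hm⟩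
  have hc : m + f + e = m + e + f := by abel
  have l0 := tl m
  have l1 := tl (m + e)
  have l2 := tl (m + f)
  clear key t0 t1 t2 tl
  rw [hc] at l2
  simp only [Toom.RR, Set.mem_ofPred_eq] at hp hq ⊢
  rcases hmp with rfl | rfl | rfl <;> rcases hmq with rfl | rfl | rfl <;>
    (try simp only [hc] at hp hq ⊢) <;> grind

theorem RR_iUnion {ι : Type*} {A : ι → Set G} {X : Set G} (hX : X ⊆ ⋃ i, A i)
    (h : ∀ i, Iso e f (A i) X) : RR e f X ⊆ ⋃ i, RR e f (A i) := by
  intro p hp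
  have key : ∀ a b, a ∈ X → b ∈ X → TT e f p a → TT e f p b → ∃ i, a ∈ A i ∧ b ∈ A i := by
    intro a b ha hb h1 h2
    obtain ⟨i, hi⟩ := Set.mem_iUnion.1 (hX ha)
    exact ⟨i, hi, (h i).2 a hi b hb ⟨p, h1, h2⟩⟩
  have t0 : TT e f p p := Or.inl rfl
  have t1 : TT e f p (p + e) := Or.inr (Or.inl rfl)
  have t2 : TT e f p (p + f) := Or.inr (Or.inr rfl)
  rcases hp with hp | hp | hp
  · obtain ⟨i, hi⟩ := key _ _ hp.1 hp.2 t0 t1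
    exact Set.mem_iUnion.2 ⟨i, Or.inl hi⟩
  · obtain ⟨i, hi⟩ := key _ _ hp.1 hp.2 t0 t2
    exact Set.mem_iUnion.2 ⟨i, Or.inr (Or.inl hi)⟩
  · obtain ⟨i, hi⟩ := key _ _ hp.1 hp.2 t1 t2
    exact Set.mem_iUnion.2 ⟨i, Or.inr (Or.inr hi)⟩

theorem RR_iter_iUnion (k : ℕ) {ι : Type*} {A : ι → Set G} {X : Set G} (hX : X ⊆ ⋃ i, A i)
    (h : ∀ i, Iso e f (A i) X) : (RR e f)^[k] X ⊆ ⋃ i, (RR e f)^[k] (A i) := by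
  induction k generalizing A X with
  | zero => exact hX
  | succ k ih => exact ih (RR_iUnion hX h) (fun i => (h i).RR)

theorem PP_iUnion {ι : Type*} {A : ι → Set G} {X : Set G} (hX : X ⊆ ⋃ i, A i)
    (h : ∀ i, Iso e f (A i) X) : PP e f X ⊆ ⋃ i, PP e f (A i) := by
  rintro p ⟨a, ha, hp⟩
  obtain ⟨i, hi⟩ := Set.mem_iUnion.1 (RR_iter_iUnion 2 hX h ha)
  exact Set.mem_iUnion.2 ⟨i, a, hi, hp⟩

/-- component of `x` -/
def comp (e f : G) (S : Set G) (x : G) : Set G := {y | Lk e f S x y}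

theorem comp_sub {S : Set G} {x : G} (hx : x ∈ S) : comp e f S x ⊆ S := by
  intro y hy
  rcases Relation.ReflTransGen.cases_tail hy with h | ⟨c, _, hc⟩
  · rw [h]; exact hx
  · exact hc.2.1

theorem mem_comp (S : Set G) (x : G) : x ∈ comp e f S x := Relation.ReflTransGen.refl

theorem comp_eq {S : Set G} {x y : G} (h : y ∈ comp e f S x) : comp e f S y = comp e f S x := by
  ext z
  exact ⟨fun hz => Lk.trans h hz, fun hz => Lk.trans (Lk.symm h) hz⟩

theorem conn_comp (S : Set G) (x : G) : Conn e f (comp e f S x) := by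
  have key : ∀ y, Lk e f S x y → Lk e f (comp e f S x) x y := by
    intro y hy
    induction hy with
    | refl => exact Relation.ReflTransGen.refl
    | @tail b c h1 h2 ih =>
      exact Relation.ReflTransGen.tail ih ⟨h1, Relation.ReflTransGen.tail h1 h2, h2.2.2⟩
  intro y hy z hz
  exact (key y hy).symm.trans (key z hz)

theorem iso_comp {S : Set G} {x : G} (hx : x ∈ S) : Iso e f (comp e f S x) S :=
  ⟨comp_sub hx, fun _ ha _ hb hab => Lk.trans ha (Lk.single ⟨comp_sub hx ha, hb, hab⟩)⟩

theorem conn_sub_comp {K S : Set G} (hK : Conn e f K) (hKS : K ⊆ S) {x y : G} (hy : y ∈ K)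
    (hyx : y ∈ comp e f S x) : K ⊆ comp e f S x := fun z hz =>
  Lk.trans hyx ((hK y hy z hz).mono hKS)

end Generic

end Toom

namespace Toom

section Plane

abbrev E1 : ℤ × ℤ := (1, 0)
abbrev E2 : ℤ × ℤ := (0, 1)

def Tri (a b m : ℤ) : Set (ℤ × ℤ) := {p | a ≤ p.1 ∧ b ≤ p.2 ∧ p.1 + p.2 < a + b + m}

theorem RR_Tri (a b m : ℤ) : RR E1 E2 (Tri a b m) ⊆ Tri a b (m - 1) := by
  rintro ⟨x, y⟩ h
  simp only [RR, Tri, Set.mem_ofPred_eq, Prod.mk_add_mk] at h ⊢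
  omega

theorem QQ_Tri (a b m : ℤ) : QQ E1 E2 (Tri a b m) ⊆ Tri a b (m + 1) := by
  rintro ⟨x, y⟩ ⟨⟨u, v⟩, h, h'⟩
  simp only [TT, Tri, Set.mem_ofPred_eq, Prod.mk_add_mk, Prod.mk.injEq] at h h' ⊢
  omega

theorem PP_Tri (a b m : ℤ) : PP E1 E2 (Tri a b m) ⊆ Tri a b (m - 1) := by
  refine (QQ_mono ((RR_mono (RR_Tri a b m)).trans (RR_Tri a b _))).trans ?_
  refine (QQ_Tri a b _).trans ?_
  rw [show m - 1 - 1 + 1 = m - 1 by ring]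

theorem RR_iter_Tri (k : ℕ) (a b m : ℤ) : (RR E1 E2)^[k] (Tri a b m) ⊆ Tri a b (m - k) := by
  induction k generalizing m with
  | zero => simp
  | succ k ih =>
    refine (RR_iter_mono k (RR_Tri a b m)).trans ((ih (m - 1)).trans ?_)
    rw [show m - 1 - (k : ℤ) = m - ((k + 1 : ℕ) : ℤ) by push_cast; ring]

theorem Tri_zero (a b : ℤ) : Tri a b 0 = ∅ := by
  ext ⟨x, y⟩
  simp only [Tri, Set.mem_ofPred_eq, Set.mem_empty_iff_false, iff_false]
  omega

theorem exists_neighbor {G : Type*} [AddCommGroup G] {e f : G} {A : Set G} {x y : G}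
    (h : Lk e f A x y) (hxy : x ≠ y) :
    ∃ z ∈ A, z ≠ x ∧ Ad e f x z := by
  induction h with
  | refl => exact absurd rfl hxy
  | @tail b c h1 h2 ih =>
    by_cases hb : x = b
    · subst hb
      exact ⟨c, h2.2.1, hxy.symm, h2.2.2⟩
    · exact ih hb

theorem bounded_of_RR (k : ℕ) {A : Set (ℤ × ℤ)} (hA : Conn E1 E2 A)
    (h : (RR E1 E2)^[k] A = ∅) : ∃ a b : ℤ, A ⊆ Tri a b k := by
  induction k generalizing A with
  | zero => exact ⟨0, 0, by rw [Function.iterate_zero, id] at h; simp [h]⟩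
  | succ k ih =>
    obtain ⟨a, b, hab⟩ := ih (conn_RR hA) h
    by_cases hs : A.Subsingleton
    · rcases hs.eq_empty_or_singleton with hs | ⟨p, hs⟩
      · exact ⟨0, 0, by simp [hs]⟩
      · refine ⟨p.1, p.2, ?_⟩
        rw [hs, Set.singleton_subset_iff]
        simp only [Tri, Set.mem_ofPred_eq]
        push_cast
        omega
    · refine ⟨a, b, ?_⟩
      intro x hx
      have : ∃ y ∈ A, x ≠ y := by
        by_contra! hcon
        exact hs (fun u hu v hv => (hcon u hu).symm.trans (hcon v hv))
      obtain ⟨y, hy, hxy⟩ := this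
      obtain ⟨z, hz, hzx, m, hmx, hmz⟩ := exists_neighbor (hA x hx y hy) hxy
      have hm : m ∈ RR E1 E2 A := mem_RR hx hz hzx.symm hmx hmz
      have := QQ_Tri a b k ⟨m, hab hm, hmx⟩
      simpa using this

end Plane

section Translate

variable {G : Type*} [AddCommGroup G] {e f : G}

/-- translate -/
def tr (v : G) (S : Set G) : Set G := {p | p - v ∈ S}

theorem TT_tr {p a v : G} : TT e f (p - v) (a - v) ↔ TT e f p a := by
  unfold TT
  rw [sub_add_eq_add_sub, sub_add_eq_add_sub]
  simp only [sub_left_inj]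

theorem Ad_tr {a b v : G} : Ad e f (a - v) (b - v) ↔ Ad e f a b := by
  constructor
  · rintro ⟨p, h1, h2⟩
    refine ⟨p + v, ?_, ?_⟩
    · rw [← TT_tr (v := v)]; simpa using h1
    · rw [← TT_tr (v := v)]; simpa using h2
  · rintro ⟨p, h1, h2⟩
    exact ⟨p - v, TT_tr.2 h1, TT_tr.2 h2⟩

theorem RR_tr (v : G) (S : Set G) : RR e f (tr v S) = tr v (RR e f S) := by
  ext p
  simp only [RR, tr, Set.mem_ofPred_eq, sub_add_eq_add_sub]

theorem QQ_tr (v : G) (S : Set G) : QQ e f (tr v S) = tr v (QQ e f S) := by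
  ext p
  constructor
  · rintro ⟨a, ha, h⟩
    exact ⟨a - v, ha, TT_tr.2 h⟩
  · rintro ⟨a, ha, h⟩
    refine ⟨a + v, by simpa [tr] using ha, ?_⟩
    rw [← TT_tr (v := v)]; simpa using h

theorem PP_tr (v : G) (S : Set G) : PP e f (tr v S) = tr v (PP e f S) := by
  simp only [PP, RR_tr, QQ_tr]

theorem RR_iter_tr (k : ℕ) (v : G) (S : Set G) :
    (RR e f)^[k] (tr v S) = tr v ((RR e f)^[k] S) := by
  induction k generalizing S with
  | zero => rfl
  | succ k ih => rw [Function.iterate_succ_apply, RR_tr, ih, Function.iterate_succ_apply]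

theorem Lk_tr {v : G} {S : Set G} {a b : G} (h : Lk e f S a b) :
    Lk e f (tr v S) (a + v) (b + v) := by
  induction h with
  | refl => exact Relation.ReflTransGen.refl
  | tail _ h2 ih =>
    refine Relation.ReflTransGen.tail ih ⟨by simpa [tr] using h2.1, by simpa [tr] using h2.2.1, ?_⟩
    rw [← Ad_tr (v := v)]; simpa using h2.2.2

theorem conn_tr {v : G} {S : Set G} (h : Conn e f S) : Conn e f (tr v S) := by
  intro a ha b hb
  have := Lk_tr (v := v) (h _ ha _ hb)
  simpa using this

theorem iso_tr {v : G} {A X : Set G} (hX : tr v X = X) (h : Iso e f A X) :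
    Iso e f (tr v A) X := by
  constructor
  · intro p hp
    rw [← hX]
    exact h.1 hp
  · intro a ha b hb hab
    rw [← hX] at hb
    exact h.2 _ ha _ hb (Ad_tr.2 hab)

end Translate

section Cover

/-- A self-touching connected set generates an immortal set. -/
theorem immortal {E Y : Set (ℤ × ℤ)} (hE : Conn E1 E2 E) {u a b : ℤ × ℤ} (hu : u ≠ 0)
    (ha : a ∈ E) (hb : b ∈ tr u E) (hab : Ad E1 E2 a b) (hY : ∀ k : ℕ, tr (k • u) E ⊆ Y) (j : ℕ) :
    ((RR E1 E2)^[j] Y).Nonempty := by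
  set F : Set (ℤ × ℤ) := ⋃ k : ℕ, tr (k • u) E with hF
  have hsub : ∀ k : ℕ, tr (k • u) E ⊆ F := fun k => Set.subset_iUnion (fun k : ℕ => tr (k • u) E) k
  have hak : ∀ k : ℕ, a + k • u ∈ tr (k • u) E := fun k => by simpa [tr] using ha
  have hbk : ∀ k : ℕ, b + k • u ∈ tr ((k + 1) • u) E := fun k => by
    have : b - u ∈ E := hb
    simp only [tr, Set.mem_ofPred_eq]
    convert this using 1
    rw [add_smul, one_smul]; abel
  have h1 : ∀ k : ℕ, Lk E1 E2 F a (a + k • u) := by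
    intro k
    induction k with
    | zero =>
      rw [zero_smul, add_zero]
      exact Relation.ReflTransGen.refl
    | succ k ih =>
      refine ih.trans ((Lk.single ⟨hsub k (hak k), hsub (k + 1) (hbk k), ?_⟩).trans
        ((conn_tr hE _ (hbk k) _ (hak (k + 1))).mono (hsub (k + 1))))
      rw [← Ad_tr (v := k • u)]; simpa using hab
  have h2 : ∀ y ∈ F, Lk E1 E2 F a y := by
    intro y hy
    obtain ⟨k, hk⟩ := Set.mem_iUnion.1 hy
    exact (h1 k).trans ((conn_tr hE _ (hak k) _ hk).mono (hsub k))
  have hconn : Conn E1 E2 F := fun y hy z hz => (h2 y hy).symm.trans (h2 z hz)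
  have hFY : F ⊆ Y := Set.iUnion_subset hY
  by_contra hne
  rw [Set.not_nonempty_iff_eq_empty] at hne
  have hFe : (RR E1 E2)^[j] F = ∅ := Set.subset_eq_empty (RR_iter_mono j hFY) hne
  obtain ⟨c, d, hcd⟩ := bounded_of_RR j hconn hFe
  obtain ⟨a1, a2⟩ := a
  obtain ⟨u1, u2⟩ := u
  have hall : ∀ k : ℕ, c ≤ a1 + k * u1 ∧ d ≤ a2 + k * u2 ∧
      (a1 + k * u1) + (a2 + k * u2) < c + d + j := by
    intro k
    have := hcd (hsub k (hak k))
    simpa [Tri] using this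
  have h0 := hall 0
  by_cases hu1 : u1 < 0
  · have h3 := (hall ((a1 - c).toNat + 1)).1
    push_cast at h3
    have : 0 ≤ a1 - c := by simp at h0; omega
    rw [Int.toNat_of_nonneg this] at h3
    nlinarith
  by_cases hu2 : u2 < 0
  · have h3 := (hall ((a2 - d).toNat + 1)).2.1
    push_cast at h3
    have : 0 ≤ a2 - d := by simp at h0; omega
    rw [Int.toNat_of_nonneg this] at h3
    nlinarith
  have hpos : 1 ≤ u1 + u2 := by
    by_contra hcon
    apply hu
    have e1 : u1 = 0 := by omega
    have e2 : u2 = 0 := by omega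
    rw [e1, e2]; rfl
  have h3 := (hall j).2.2
  simp at h0
  nlinarith

variable {n : ℕ}

abbrev F1 (n : ℕ) : Tor n := (1, 0)
abbrev F2 (n : ℕ) : Tor n := (0, 1)

def pr (n : ℕ) : ℤ × ℤ →+ Tor n where
  toFun p := ((p.1 : ZMod n), (p.2 : ZMod n))
  map_zero' := by simp
  map_add' p q := by simp

theorem pr_E1 : pr n E1 = F1 n := by simp [pr]
theorem pr_E2 : pr n E2 = F2 n := by simp [pr]

theorem pr_surj : Function.Surjective (pr n) := by
  rintro ⟨x, y⟩
  obtain ⟨a, rfl⟩ := ZMod.intCast_surjective x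
  obtain ⟨b, rfl⟩ := ZMod.intCast_surjective y
  exact ⟨(a, b), rfl⟩

theorem pr_TT {p a : ℤ × ℤ} (h : TT E1 E2 p a) : TT (F1 n) (F2 n) (pr n p) (pr n a) := by
  rcases h with rfl | rfl | rfl
  · exact Or.inl rfl
  · exact Or.inr (Or.inl (by rw [map_add, pr_E1]))
  · exact Or.inr (Or.inr (by rw [map_add, pr_E2]))

/-- lifts of tiles through a given point -/
theorem lift_center {q : Tor n} {a : ℤ × ℤ} (h : TT (F1 n) (F2 n) q (pr n a)) :
    ∃ p, pr n p = q ∧ TT E1 E2 p a := by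
  rcases h with h | h | h
  · exact ⟨a, h, Or.inl rfl⟩
  · exact ⟨a - E1, by rw [map_sub, pr_E1, h]; abel, Or.inr (Or.inl (by abel))⟩
  · exact ⟨a - E2, by rw [map_sub, pr_E2, h]; abel, Or.inr (Or.inr (by abel))⟩

theorem lift_point {b : Tor n} {p : ℤ × ℤ} (h : TT (F1 n) (F2 n) (pr n p) b) :
    ∃ c, pr n c = b ∧ TT E1 E2 p c := by
  rcases h with h | h | h
  · exact ⟨p, h.symm, Or.inl rfl⟩
  · exact ⟨p + E1, by rw [map_add, pr_E1, h], Or.inr (Or.inl rfl)⟩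
  · exact ⟨p + E2, by rw [map_add, pr_E2, h], Or.inr (Or.inr rfl)⟩

theorem RR_pre (S : Set (Tor n)) :
    RR E1 E2 (pr n ⁻¹' S) = pr n ⁻¹' (RR (F1 n) (F2 n) S) := by
  ext p
  simp only [RR, Set.mem_ofPred_eq, Set.mem_preimage, map_add, pr_E1, pr_E2]

theorem RR_iter_pre (k : ℕ) (S : Set (Tor n)) :
    (RR E1 E2)^[k] (pr n ⁻¹' S) = pr n ⁻¹' ((RR (F1 n) (F2 n))^[k] S) := by
  induction k generalizing S with
  | zero => rfl
  | succ k ih => rw [Function.iterate_succ_apply, RR_pre, ih, Function.iterate_succ_apply]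

theorem QQ_pre (S : Set (Tor n)) :
    QQ E1 E2 (pr n ⁻¹' S) = pr n ⁻¹' (QQ (F1 n) (F2 n) S) := by
  ext p
  constructor
  · rintro ⟨a, ha, h⟩
    exact ⟨pr n a, ha, pr_TT h⟩
  · rintro ⟨a, ha, h⟩
    obtain ⟨c, hc, h'⟩ := lift_center h
    exact ⟨c, by rw [Set.mem_preimage, hc]; exact ha, h'⟩

theorem PP_pre (S : Set (Tor n)) :
    PP E1 E2 (pr n ⁻¹' S) = pr n ⁻¹' (PP (F1 n) (F2 n) S) := by
  simp only [PP, RR_pre, QQ_pre]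

theorem tr_pre (S : Set (Tor n)) {v : ℤ × ℤ} (hv : pr n v = 0) :
    tr v (pr n ⁻¹' S) = pr n ⁻¹' S := by
  ext p
  simp [tr, hv]

theorem pre_nonempty {S : Set (Tor n)} : (pr n ⁻¹' S).Nonempty ↔ S.Nonempty := by
  constructor
  · rintro ⟨x, hx⟩
    exact ⟨_, hx⟩
  · rintro ⟨x, hx⟩
    obtain ⟨y, rfl⟩ := pr_surj x
    exact ⟨y, hx⟩

theorem step_mortal {C : Set (Tor n)} (hC : Conn (F1 n) (F2 n) C) (k : ℕ)
    (hk : (RR (F1 n) (F2 n))^[k + 1] C = ∅) :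
    (RR (F1 n) (F2 n))^[k] (PP (F1 n) (F2 n) C) = ∅ ∨
      ∀ j, ((RR (F1 n) (F2 n))^[j] (PP (F1 n) (F2 n) C)).Nonempty := by
  rcases C.eq_empty_or_nonempty with rfl | ⟨x0, hx0⟩
  · left
    rw [PP_empty]
    have : ∀ k, (RR (F1 n) (F2 n))^[k] ∅ = ∅ := fun k => Function.iterate_fixed RR_empty k
    exact this k
  obtain ⟨x, rfl⟩ := pr_surj x0
  set X := pr n ⁻¹' C with hX
  have hxX : x ∈ X := hx0
  set D := comp E1 E2 X x with hD
  have hDX : D ⊆ X := comp_sub hxX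
  have hDc : Conn E1 E2 D := conn_comp X x
  have hDi : Iso E1 E2 D X := iso_comp hxX
  have hlift : ∀ y, Lk (F1 n) (F2 n) C (pr n x) y → ∃ z ∈ D, pr n z = y := by
    intro y hy
    induction hy with
    | refl => exact ⟨x, mem_comp X x, rfl⟩
    | @tail b c h1 h2 ih =>
      obtain ⟨z, hz, rfl⟩ := ih
      obtain ⟨_, hcC, q, hq1, hq2⟩ := h2
      obtain ⟨p, rfl, hp⟩ := lift_center hq1
      obtain ⟨w, rfl, hw⟩ := lift_point hq2
      exact ⟨w, hDi.2 z hz w hcC ⟨p, hp, hw⟩, rfl⟩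
  let ι := {v : ℤ × ℤ // pr n v = 0}
  have hcov : X ⊆ ⋃ v : ι, tr v.1 D := by
    intro y hy
    obtain ⟨z, hz, hzy⟩ := hlift (pr n y) (hC _ hx0 _ hy)
    exact Set.mem_iUnion.2 ⟨⟨y - z, by rw [map_sub, hzy, sub_self]⟩, by simpa [tr] using hz⟩
  set E := PP E1 E2 D with hE
  set Y := PP E1 E2 X with hY
  have hYpre : Y = pr n ⁻¹' (PP (F1 n) (F2 n) C) := PP_pre C
  have hEY : E ⊆ Y := PP_mono hDX
  have hEYv : ∀ v, pr n v = 0 → tr v E ⊆ Y := by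
    intro v hv p hp
    have h1 : p ∈ tr v Y := hEY hp
    rwa [hYpre, tr_pre _ hv, ← hYpre] at h1
  have hcovY : Y ⊆ ⋃ v : ι, tr v.1 E := by
    have := PP_iUnion hcov (fun v : ι => iso_tr (tr_pre C v.2) hDi)
    simpa only [PP_tr] using this
  by_cases hiso : ∀ v : ι, Iso E1 E2 (tr v.1 E) Y
  · left
    have h1 : (RR E1 E2)^[k + 1] D = ∅ := by
      have : (RR E1 E2)^[k + 1] X = ∅ := by rw [hX, RR_iter_pre, hk, Set.preimage_empty]
      exact Set.subset_eq_empty (RR_iter_mono _ hDX) this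
    obtain ⟨a, b, hab⟩ := bounded_of_RR _ hDc h1
    have h2 : (RR E1 E2)^[k] E = ∅ := by
      have h3 : E ⊆ Tri a b k := by
        have := (PP_mono hab).trans (PP_Tri a b _)
        simpa using this
      have h4 := (RR_iter_mono k h3).trans (RR_iter_Tri k a b k)
      rw [sub_self, Tri_zero] at h4
      exact Set.subset_eq_empty h4 rfl
    have h5 := RR_iter_iUnion k hcovY hiso
    rw [← Set.not_nonempty_iff_eq_empty, ← pre_nonempty, ← RR_iter_pre, ← hYpre]
    rintro ⟨p, hp⟩
    obtain ⟨v, hv⟩ := Set.mem_iUnion.1 (h5 hp)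
    rw [RR_iter_tr, h2] at hv
    exact hv
  · right
    intro j
    rw [← pre_nonempty, ← RR_iter_pre, ← hYpre]
    push Not at hiso
    obtain ⟨v, hv⟩ := hiso
    have : ∃ a ∈ tr v.1 E, ∃ b ∈ Y, Ad E1 E2 a b ∧ b ∉ tr v.1 E := by
      by_contra! hcon
      exact hv ⟨hEYv _ v.2, fun a ha b hb hab => hcon a ha b hb hab⟩
    obtain ⟨a, ha, b, hb, hab, hbn⟩ := this
    obtain ⟨w, hw⟩ := Set.mem_iUnion.1 (hcovY hb)
    have hu : w.1 - v.1 ≠ 0 := by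
      intro h
      rw [sub_eq_zero] at h
      rw [h] at hw
      exact hbn hw
    refine immortal (E := E) (u := w.1 - v.1) (a := a - v.1) (b := b - v.1)
      (conn_PP hDc) hu ha ?_ (Ad_tr.2 hab) ?_ j
    · have : b - w.1 ∈ E := hw
      simpa [tr] using this
    · intro k
      exact hEYv _ (by rw [map_nsmul, map_sub, v.2, w.2]; simp)

/-- If all iterates are mortal, survival under `PP` implies survival under `RR`. -/
theorem survive {C : Set (Tor n)} (hC : Conn (F1 n) (F2 n) C) (k : ℕ)
    (hm : ∀ l ≤ k, ∃ j, (RR (F1 n) (F2 n))^[j] ((PP (F1 n) (F2 n))^[l] C) = ∅)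
    (hk : (RR (F1 n) (F2 n))^[k] C = ∅) : (PP (F1 n) (F2 n))^[k] C = ∅ := by
  induction k generalizing C with
  | zero => exact hk
  | succ k ih =>
    refine ih (conn_PP hC) (fun l hl => hm (l + 1) (by omega)) ?_
    rcases step_mortal hC k hk with h | h
    · exact h
    · obtain ⟨j, hj⟩ := hm 1 (by omega)
      have := h j
      rw [Function.iterate_one] at hj
      rw [hj] at this
      exact absurd this Set.not_nonempty_empty

theorem mem_QQ_iter (i a b : ℕ) (h : a + b ≤ i) (p : Tor n) :
    p + ((a : ZMod n), (b : ZMod n)) ∈ (QQ (F1 n) (F2 n))^[i] {p} := by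
  induction i generalizing a b with
  | zero =>
    have ha : a = 0 := by omega
    have hb : b = 0 := by omega
    subst ha hb
    simp
  | succ i ih =>
    rw [Function.iterate_succ_apply']
    rcases Nat.eq_zero_or_pos a with rfl | ha
    · rcases Nat.eq_zero_or_pos b with rfl | hb
      · exact sub_QQ _ (ih 0 0 (by omega))
      · obtain ⟨b, rfl⟩ := Nat.exists_eq_add_of_le' hb
        refine ⟨_, ih 0 b (by omega), Or.inr (Or.inr ?_)⟩
        ext <;> simp [add_assoc]
    · obtain ⟨a, rfl⟩ := Nat.exists_eq_add_of_le' ha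
      refine ⟨_, ih a b (by omega), Or.inr (Or.inl ?_)⟩
      ext <;> simp [add_assoc]

theorem QQ_full [NeZero n] (p : Tor n) : (QQ (F1 n) (F2 n))^[2 * n] {p} = Set.univ := by
  ext q
  simp only [Set.mem_univ, iff_true]
  have h := mem_QQ_iter (2 * n) (q - p).1.val (q - p).2.val
    (by have := ZMod.val_lt (q - p).1; have := ZMod.val_lt (q - p).2; omega) p
  have h2 : p + (((q - p).1.val : ZMod n), ((q - p).2.val : ZMod n)) = q := by
    rw [ZMod.natCast_zmod_val, ZMod.natCast_zmod_val]; ext <;> simp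
  rwa [h2] at h

theorem QQ_card [NeZero n] (r : ℕ) (hr : r ≤ n) (p : Tor n) :
    r * r ≤ ((QQ (F1 n) (F2 n))^[2 * r] {p}).ncard := by
  let g : Fin r × Fin r → Tor n := fun x => p + ((x.1.1 : ZMod n), (x.2.1 : ZMod n))
  have hg : Function.Injective g := by
    rintro ⟨a, b⟩ ⟨c, d⟩ h
    simp only [g, add_right_inj, Prod.mk.injEq] at h
    have h1 := (ZMod.natCast_eq_natCast_iff' _ _ _).1 h.1
    have h2 := (ZMod.natCast_eq_natCast_iff' _ _ _).1 h.2
    rw [Nat.mod_eq_of_lt (by omega), Nat.mod_eq_of_lt (by omega)] at h1 h2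
    ext <;> simp [h1, h2]
  have h1 : (Set.range g).ncard = r * r := by
    rw [← Set.image_univ, Set.ncard_image_of_injective _ hg, Set.ncard_univ]
    simp
  rw [← h1]
  refine Set.ncard_le_ncard ?_ (Set.toFinite _)
  rintro _ ⟨x, rfl⟩
  exact mem_QQ_iter _ _ _ (by omega) p

end Cover

end Toom

namespace Toom

section Counting

open Classical in
/-- the finite set of components -/
noncomputable def comps {G : Type*} [AddCommGroup G] [Fintype G] (e f : G) (S : Set G) :
    Finset (Set G) :=
  Finset.univ.filter (fun C => ∃ x ∈ S, C = comp e f S x)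

variable {G : Type*} [AddCommGroup G] [Fintype G] {e f : G}

theorem mem_comps {S C : Set G} : C ∈ comps e f S ↔ ∃ x ∈ S, C = comp e f S x := by
  simp [comps]

theorem comps_conn {S C : Set G} (h : C ∈ comps e f S) : Conn e f C := by
  obtain ⟨x, _, rfl⟩ := mem_comps.1 h
  exact conn_comp S x

theorem comps_sub {S C : Set G} (h : C ∈ comps e f S) : C ⊆ S := by
  obtain ⟨x, hx, rfl⟩ := mem_comps.1 h
  exact comp_sub hx

theorem comps_iso {S C : Set G} (h : C ∈ comps e f S) : Iso e f C S := by
  obtain ⟨x, hx, rfl⟩ := mem_comps.1 h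
  exact iso_comp hx

theorem comps_nonempty {S C : Set G} (h : C ∈ comps e f S) : C.Nonempty := by
  obtain ⟨x, hx, rfl⟩ := mem_comps.1 h
  exact ⟨x, mem_comp S x⟩

theorem comps_absorb {S C K : Set G} (h : C ∈ comps e f S) (hK : Conn e f K) (hKS : K ⊆ S)
    (hKC : (K ∩ C).Nonempty) : K ⊆ C := by
  obtain ⟨x, hx, rfl⟩ := mem_comps.1 h
  obtain ⟨y, hy, hyx⟩ := hKC
  exact conn_sub_comp hK hKS hy hyx

theorem comps_eq {S C C' : Set G} (h : C ∈ comps e f S) (h' : C' ∈ comps e f S)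
    (hi : (C ∩ C').Nonempty) : C = C' :=
  Set.Subset.antisymm (comps_absorb h' (comps_conn h) (comps_sub h) hi)
    (comps_absorb h (comps_conn h') (comps_sub h') (by rwa [Set.inter_comm]))

theorem comps_card_le (S : Set G) : (comps e f S).card ≤ Fintype.card G := by
  classical
  have : comps e f S ⊆ Finset.univ.image (fun x => comp e f S x) := by
    intro C hC
    obtain ⟨x, _, rfl⟩ := mem_comps.1 hC
    exact Finset.mem_image_of_mem _ (Finset.mem_univ x)
  exact (Finset.card_le_card this).trans Finset.card_image_le

theorem comps_cover (S : Set G) : S ⊆ ⋃ C : comps e f S, C.1 := by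
  intro x hx
  exact Set.mem_iUnion.2 ⟨⟨comp e f S x, mem_comps.2 ⟨x, hx, rfl⟩⟩, mem_comp S x⟩

theorem eq_empty_of_comps {S : Set G} (h : (comps e f S).card = 0) : S = ∅ := by
  by_contra hne
  obtain ⟨x, hx⟩ := Set.nonempty_iff_ne_empty.2 hne
  have : comp e f S x ∈ comps e f S := mem_comps.2 ⟨x, hx, rfl⟩
  rw [Finset.card_eq_zero.1 h] at this
  simp at this

theorem weight_step (S : Set G) (w w' : Set G → ℕ) (hw : ∀ D, 1 ≤ w D) (hw' : ∀ D, w' D ≤ 2)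
    (hww : ∀ D, w' (PP e f D) ≤ w D) :
    ∑ D ∈ comps e f (PP e f S), w' D ≤ ∑ D ∈ comps e f S, w D := by
  classical
  let anc : Set G → Finset (Set G) := fun D' =>
    (comps e f S).filter (fun D => (PP e f D ∩ D').Nonempty)
  have hcov : PP e f S ⊆ ⋃ C : comps e f S, PP e f C.1 :=
    PP_iUnion (comps_cover S) (fun C => comps_iso C.2)
  have h1 : ∀ D' ∈ comps e f (PP e f S), w' D' ≤ ∑ D ∈ anc D', w D := by
    intro D' hD'
    have hex : ∀ x ∈ D', ∃ D ∈ anc D', x ∈ PP e f D := by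
      intro x hx
      obtain ⟨D, hD⟩ := Set.mem_iUnion.1 (hcov (comps_sub hD' hx))
      exact ⟨D.1, Finset.mem_filter.2 ⟨D.2, x, hD, hx⟩, hD⟩
    obtain ⟨x, hx⟩ := comps_nonempty hD'
    obtain ⟨D, hD, hxD⟩ := hex x hx
    by_cases hone : ∀ B ∈ anc D', B = D
    · have heq : D' = PP e f D := by
        apply Set.Subset.antisymm
        · intro y hy
          obtain ⟨B, hB, hyB⟩ := hex y hy
          rw [hone B hB] at hyB
          exact hyB
        · have hD2 := (Finset.mem_filter.1 hD)
          exact comps_absorb hD' (conn_PP (comps_conn hD2.1)) (PP_mono (comps_sub hD2.1)) hD2.2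
      calc w' D' = w' (PP e f D) := by rw [← heq]
        _ ≤ w D := hww D
        _ ≤ _ := Finset.single_le_sum (f := w) (fun _ _ => Nat.zero_le _) hD
    · push Not at hone
      obtain ⟨B, hB, hBD⟩ := hone
      have hsub : ({B, D} : Finset (Set G)) ⊆ anc D' := by
        intro Z hZ
        rcases Finset.mem_insert.1 hZ with rfl | hZ
        · exact hB
        · rw [Finset.mem_singleton.1 hZ]; exact hD
      have h2 := Finset.sum_le_sum_of_subset (f := w) hsub
      rw [Finset.sum_pair hBD] at h2
      have := hw B
      have := hw D
      have := hw' D'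
      omega
  refine (Finset.sum_le_sum h1).trans ?_
  rw [← Finset.sum_biUnion]
  · apply Finset.sum_le_sum_of_subset
    intro D hD
    obtain ⟨D', _, hD'⟩ := Finset.mem_biUnion.1 hD
    exact (Finset.mem_filter.1 hD').1
  · intro A hA B hB hAB
    rw [Function.onFun, Finset.disjoint_left]
    intro D hDA hDB
    apply hAB
    have hDA := Finset.mem_filter.1 hDA
    have hDB := Finset.mem_filter.1 hDB
    have hc := conn_PP (comps_conn hDA.1)
    have hs := PP_mono (e := e) (f := f) (comps_sub hDA.1)
    have sA := comps_absorb hA hc hs hDA.2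
    have sB := comps_absorb hB hc hs hDB.2
    obtain ⟨x, hx, _⟩ := hDA.2
    exact comps_eq hA hB ⟨x, sA hx, sB hx⟩

/-- pure: an iterate of a single component -/
def Pure (e f : G) (S : Set G) (j : ℕ) (D : Set G) : Prop :=
  ∃ C ∈ comps e f S, D = (PP e f)^[j] C

open Classical in
theorem weight_iter (S : Set G) (j : ℕ) :
    ∑ D ∈ comps e f ((PP e f)^[j] S), (if Pure e f S j D then 1 else 2) ≤ (comps e f S).card := by
  induction j with
  | zero =>
    rw [Finset.card_eq_sum_ones]
    apply Finset.sum_le_sum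
    intro D hD
    rw [if_pos ⟨D, hD, rfl⟩]
  | succ j ih =>
    refine le_trans ?_ ih
    rw [Function.iterate_succ_apply']
    apply weight_step
    · intro D; split_ifs <;> simp
    · intro D; split_ifs <;> simp
    · intro D
      by_cases h : Pure e f S j D
      · have h' : Pure e f S (j + 1) (PP e f D) := by
          obtain ⟨C, hC, rfl⟩ := h
          exact ⟨C, hC, (Function.iterate_succ_apply' _ _ _).symm⟩
        rw [if_pos h, if_pos h']
      · rw [if_neg h]; split_ifs <;> simp

open Classical in
theorem count_iter (S : Set G) (j : ℕ) :
    2 * (comps e f ((PP e f)^[j] S)).card ≤ (comps e f S).card +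
      ((comps e f ((PP e f)^[j] S)).filter (Pure e f S j)).card := by
  have h := weight_iter (e := e) (f := f) S j
  rw [Finset.card_filter]
  have h2 : 2 * (comps e f ((PP e f)^[j] S)).card =
      ∑ D ∈ comps e f ((PP e f)^[j] S), (if Pure e f S j D then 1 else 2) +
      ∑ D ∈ comps e f ((PP e f)^[j] S), (if Pure e f S j D then 1 else 0) := by
    rw [← Finset.sum_add_distrib, mul_comm, ← smul_eq_mul, ← Finset.sum_const]
    apply Finset.sum_congr rfl
    intro D _
    split_ifs <;> rfl
  omega

end Counting

section Torus

variable {n : ℕ} [NeZero n]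

open Classical in
theorem pure_bound (S : Set (Tor n)) (r : ℕ)
    (hm : ∀ l ≤ 4 * r, (RR (F1 n) (F2 n))^[4 * n] ((PP (F1 n) (F2 n))^[l] S) = ∅) :
    ((comps (F1 n) (F2 n) ((PP (F1 n) (F2 n))^[4 * r] S)).filter
      (Pure (F1 n) (F2 n) S (4 * r))).card * (r * r) ≤ n * n := by
  set P := (comps (F1 n) (F2 n) ((PP (F1 n) (F2 n))^[4 * r] S)).filter
      (Pure (F1 n) (F2 n) S (4 * r)) with hP
  have hex : ∀ D, ∃ C, D ∈ P → C ∈ comps (F1 n) (F2 n) S ∧ D = (PP (F1 n) (F2 n))^[4 * r] C := by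
    intro D
    by_cases hD : D ∈ P
    · obtain ⟨C, h1, h2⟩ := (Finset.mem_filter.1 hD).2
      exact ⟨C, fun _ => ⟨h1, h2⟩⟩
    · exact ⟨∅, fun h => absurd h hD⟩
  choose c hc using hex
  have hsurv : ∀ D ∈ P, ((RR (F1 n) (F2 n))^[4 * r] (c D)).Nonempty := by
    intro D hD
    by_contra hne
    rw [Set.not_nonempty_iff_eq_empty] at hne
    obtain ⟨h1, h2⟩ := hc D hD
    have h3 := survive (comps_conn h1) (4 * r) (fun l hl => ⟨4 * n, Set.subset_eq_empty
      (RR_iter_mono _ (PP_iter_mono l (comps_sub h1))) (hm l hl)⟩) hne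
    rw [← h2] at h3
    have h4 := comps_nonempty (Finset.mem_filter.1 hD).1
    rw [h3] at h4
    exact Set.not_nonempty_empty h4
  rcases le_or_gt r n with hr | hr
  · let B : Set (Tor n) → Finset (Tor n) := fun D => ((PP (F1 n) (F2 n))^[2 * r] (c D)).toFinset
    have hB : ∀ D ∈ P, r * r ≤ (B D).card := by
      intro D hD
      obtain ⟨p, hp⟩ := hsurv D hD
      rw [← Set.ncard_eq_toFinset_card']
      refine (QQ_card r hr p).trans (Set.ncard_le_ncard ?_ (Set.toFinite _))
      refine (QQ_iter_mono _ ?_).trans (fat (2 * r) (c D))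
      rw [Set.singleton_subset_iff, show 2 * (2 * r) = 4 * r by ring]
      exact hp
    have hdisj : (P : Set (Set (Tor n))).PairwiseDisjoint B := by
      intro D hD D' hD' hne
      rw [Function.onFun, Finset.disjoint_left]
      intro x hx hx'
      rw [Set.mem_toFinset] at hx hx'
      apply hne
      obtain ⟨h1, h2⟩ := hc D hD
      obtain ⟨h1', h2'⟩ := hc D' hD'
      have hK := conn_union (conn_PP_iter (2 * r) (comps_conn h1))
        (conn_PP_iter (2 * r) (comps_conn h1')) hx hx'
      have hK2 := conn_PP_iter (2 * r) hK
      have e4 : ∀ C, (PP (F1 n) (F2 n))^[2 * r] ((PP (F1 n) (F2 n))^[2 * r] C) =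
          (PP (F1 n) (F2 n))^[4 * r] C := by
        intro C
        rw [← Function.iterate_add_apply]
        congr 1; ring_nf
      have s1 : D ⊆ (PP (F1 n) (F2 n))^[2 * r] ((PP (F1 n) (F2 n))^[2 * r] (c D) ∪
          (PP (F1 n) (F2 n))^[2 * r] (c D')) := by
        conv_lhs => rw [h2, ← e4]
        exact PP_iter_mono _ Set.subset_union_left
      have s2 : D' ⊆ (PP (F1 n) (F2 n))^[2 * r] ((PP (F1 n) (F2 n))^[2 * r] (c D) ∪
          (PP (F1 n) (F2 n))^[2 * r] (c D')) := by
        conv_lhs => rw [h2', ← e4]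
        exact PP_iter_mono _ Set.subset_union_right
      have s3 : (PP (F1 n) (F2 n))^[2 * r] ((PP (F1 n) (F2 n))^[2 * r] (c D) ∪
          (PP (F1 n) (F2 n))^[2 * r] (c D')) ⊆ (PP (F1 n) (F2 n))^[4 * r] S := by
        rw [← e4 S]
        exact PP_iter_mono _ (Set.union_subset (PP_iter_mono _ (comps_sub h1))
          (PP_iter_mono _ (comps_sub h1')))
      have m1 := (Finset.mem_filter.1 hD).1
      have m2 := (Finset.mem_filter.1 hD').1
      obtain ⟨y, hy⟩ := comps_nonempty m1
      obtain ⟨z, hz⟩ := comps_nonempty m2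
      have a1 := comps_absorb m1 hK2 s3 ⟨y, s1 hy, hy⟩
      exact comps_eq m1 m2 ⟨z, a1 (s2 hz), hz⟩
    calc P.card * (r * r) = ∑ _D ∈ P, r * r := by rw [Finset.sum_const, smul_eq_mul]
      _ ≤ ∑ D ∈ P, (B D).card := Finset.sum_le_sum hB
      _ = (P.biUnion B).card := (Finset.card_biUnion hdisj).symm
      _ ≤ Fintype.card (Tor n) := Finset.card_le_univ _
      _ = n * n := by rw [Fintype.card_prod, ZMod.card]
  · have : P = ∅ := by
      rw [Finset.eq_empty_iff_forall_notMem]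
      intro D hD
      obtain ⟨h1, h2⟩ := hc D hD
      have h3 := hsurv D hD
      have h4 : (RR (F1 n) (F2 n))^[4 * r] (c D) = ∅ := by
        rw [show 4 * r = (4 * r - 4 * n) + 4 * n by omega, Function.iterate_add_apply]
        have h5 : (RR (F1 n) (F2 n))^[4 * n] (c D) = ∅ :=
          Set.subset_eq_empty (RR_iter_mono _ (comps_sub h1)) (hm 0 (by omega))
        rw [h5]
        exact Function.iterate_fixed RR_empty _
      rw [h4] at h3
      exact Set.not_nonempty_empty h3
    rw [this]; simp

theorem dies (S : Set (Tor n))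
    (hm : ∀ t ≤ 72 * n, (RR (F1 n) (F2 n))^[4 * n] ((PP (F1 n) (F2 n))^[t] S) = ∅) :
    ∃ t ≤ 72 * n, (PP (F1 n) (F2 n))^[t] S = ∅ := by
  let N : ℕ → ℕ := fun t => (comps (F1 n) (F2 n) ((PP (F1 n) (F2 n))^[t] S)).card
  have hwin : ∀ t r, t + 4 * r ≤ 72 * n → ∃ q, 2 * N (t + 4 * r) ≤ N t + q ∧
      q * (r * r) ≤ n * n := by
    intro t r htr
    have hadd : ∀ l, (PP (F1 n) (F2 n))^[l] ((PP (F1 n) (F2 n))^[t] S) =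
        (PP (F1 n) (F2 n))^[t + l] S := by
      intro l
      rw [← Function.iterate_add_apply, add_comm]
    have h1 := pure_bound ((PP (F1 n) (F2 n))^[t] S) r (fun l hl => by
      rw [hadd]; exact hm _ (by omega))
    have h2 := count_iter (e := F1 n) (f := F2 n) ((PP (F1 n) (F2 n))^[t] S) (4 * r)
    refine ⟨_, ?_, h1⟩
    simp only [N]
    rw [← hadd]
    exact h2
  have hrec : ∀ k t, t + 12 = 12 * 2 ^ k → t ≤ 72 * n → N t * 4 ^ k ≤ 7 * (n * n) := by
    intro k
    induction k with
    | zero =>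
      intro t _ _
      have : N t ≤ n * n := by
        have := comps_card_le (e := F1 n) (f := F2 n) ((PP (F1 n) (F2 n))^[t] S)
        rwa [Fintype.card_prod, ZMod.card] at this
      omega
    | succ k ih =>
      intro t' ht' hle
      have hp : 1 ≤ 2 ^ k := Nat.one_le_two_pow
      rw [pow_succ] at ht'
      obtain ⟨t, ht⟩ : ∃ t, t + 12 = 12 * 2 ^ k := ⟨12 * 2 ^ k - 12, by omega⟩
      have h0 := ih t ht (by omega)
      obtain ⟨q1, a1, b1⟩ := hwin t (2 ^ k) (by omega)
      obtain ⟨q2, a2, b2⟩ := hwin (t + 4 * 2 ^ k) (2 ^ k) (by omega)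
      obtain ⟨q3, a3, b3⟩ := hwin (t + 4 * 2 ^ k + 4 * 2 ^ k) (2 ^ k) (by omega)
      have heq : t + 4 * 2 ^ k + 4 * 2 ^ k + 4 * 2 ^ k = t' := by omega
      rw [heq] at a3
      have h4 : 2 ^ k * 2 ^ k = 4 ^ k := by rw [← mul_pow]; norm_num
      rw [h4] at b1 b2 b3
      have h8 : 8 * N t' ≤ N t + q1 + 2 * q2 + 4 * q3 := by omega
      have h9 := Nat.mul_le_mul_right (4 ^ k) h8
      rw [pow_succ]
      nlinarith
  have hn : 0 < n := Nat.pos_of_ne_zero (NeZero.ne n)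
  set k := Nat.log 2 (3 * n) + 1 with hk
  have hk1 : 3 * n < 2 ^ k := Nat.lt_pow_succ_log_self (by norm_num) _
  have hk2 : 2 ^ k ≤ 6 * n := by
    have := Nat.pow_log_le_self 2 (x := 3 * n) (by omega)
    rw [hk, pow_succ]; omega
  refine ⟨12 * 2 ^ k - 12, by omega, ?_⟩
  have h := hrec k (12 * 2 ^ k - 12) (by omega) (by omega)
  have h4 : 2 ^ k * 2 ^ k = 4 ^ k := by rw [← mul_pow]; norm_num
  apply eq_empty_of_comps (e := F1 n) (f := F2 n)
  change N (12 * 2 ^ k - 12) = 0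
  by_contra hne
  have h1 : 1 ≤ N (12 * 2 ^ k - 12) := Nat.one_le_iff_ne_zero.2 hne
  have h2 : 4 ^ k ≤ N (12 * 2 ^ k - 12) * 4 ^ k := Nat.le_mul_of_pos_left _ h1
  rw [← h4] at h h2
  nlinarith

theorem RR_univ {G : Type*} [AddCommGroup G] (e f : G) : RR e f Set.univ = Set.univ := by
  ext; simp [RR]

theorem PP_univ {G : Type*} [AddCommGroup G] (e f : G) : PP e f Set.univ = Set.univ := by
  rw [PP, RR_univ, RR_univ]
  exact Set.univ_subset_iff.1 (sub_QQ _)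

theorem main (S : Set (Tor n)) :
    (PP (F1 n) (F2 n))^[100 * n] S = ∅ ∨ (PP (F1 n) (F2 n))^[100 * n] S = Set.univ := by
  have split : ∀ t ≤ 100 * n, (PP (F1 n) (F2 n))^[100 * n] S =
      (PP (F1 n) (F2 n))^[100 * n - t] ((PP (F1 n) (F2 n))^[t] S) := by
    intro t ht
    rw [← Function.iterate_add_apply]
    congr 1
    omega
  by_cases hm : ∀ t ≤ 72 * n, (RR (F1 n) (F2 n))^[4 * n] ((PP (F1 n) (F2 n))^[t] S) = ∅
  · left
    obtain ⟨t, ht, h⟩ := dies S hm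
    rw [split t (by omega), h]
    exact Function.iterate_fixed PP_empty _
  · right
    push Not at hm
    obtain ⟨t, ht, h⟩ := hm
    obtain ⟨p, hp⟩ := h
    have hfull : (PP (F1 n) (F2 n))^[t + 2 * n] S = Set.univ := by
      rw [add_comm, Function.iterate_add_apply, ← Set.univ_subset_iff, ← QQ_full p]
      refine (QQ_iter_mono _ ?_).trans (fat (2 * n) _)
      rw [Set.singleton_subset_iff, show 2 * (2 * n) = 4 * n by ring]
      exact hp
    rw [split (t + 2 * n) (by omega), hfull]
    exact Function.iterate_fixed (PP_univ _ _) _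

end Torus

theorem ROpT_eq {n : ℕ} (hn : 2 ≤ n) (S : Set (Tor n)) : ROpT S = RR (F1 n) (F2 n) S := by
  have : NeZero n := ⟨by omega⟩
  have : Fact (1 < n) := ⟨hn⟩
  ext p
  change 1 < (S ∩ tileT p).ncard ↔ _
  rw [Set.one_lt_ncard_iff (Set.toFinite _)]
  constructor
  · rintro ⟨a, b, ha, hb, hab⟩
    exact mem_RR ha.1 hb.1 hab ha.2 hb.2
  · rintro (h | h | h)
    · exact ⟨_, _, ⟨h.1, Or.inl rfl⟩, ⟨h.2, Or.inr (Or.inl rfl)⟩, by simp⟩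
    · exact ⟨_, _, ⟨h.1, Or.inl rfl⟩, ⟨h.2, Or.inr (Or.inr rfl)⟩, by simp⟩
    · exact ⟨_, _, ⟨h.1, Or.inr (Or.inl rfl)⟩, ⟨h.2, Or.inr (Or.inr rfl)⟩, by simp⟩

theorem QOpT_eq {n : ℕ} (S : Set (Tor n)) : QOpT S = QQ (F1 n) (F2 n) S := by
  ext p
  simp only [QOpT, Set.mem_iUnion, exists_prop]
  rfl

theorem RPlusT_eq {n : ℕ} (hn : 2 ≤ n) :
    (RPlusT : Set (Tor n) → Set (Tor n)) = PP (F1 n) (F2 n) := by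
  funext S
  rw [RPlusT, PP, QOpT_eq, ROpT_eq hn, ROpT_eq hn]

theorem RPlusT_one (S : Set (Tor 1)) : RPlusT S = ∅ := by
  have hR : ∀ S : Set (Tor 1), ROpT S = ∅ := by
    intro S
    ext p
    simp only [ROpT, Set.mem_ofPred_eq, Set.mem_empty_iff_false, iff_false, not_le]
    have := Set.ncard_le_one_of_subsingleton (S ∩ tileT p)
    omega
  rw [RPlusT, hR, QOpT_eq, QQ_empty]

end Toom

/-- Consensus theorem: there is a constant `c` such that for every `n ≥ 1` and
every subset `S` of the torus, `(R⁺)^{⌈cn⌉}(S)` is empty or the full torus. -/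
theorem consensus : ∃ c : ℝ, ∀ n : ℕ, 0 < n → ∀ S : Set (Tor n),
    RPlusT^[⌈c * (n : ℝ)⌉₊] S = ∅ ∨ RPlusT^[⌈c * (n : ℝ)⌉₊] S = Set.univ := by

  refine ⟨100, fun n hn S => ?_⟩
  have hc : ⌈(100 : ℝ) * (n : ℝ)⌉₊ = 100 * n := by
    have : (100 : ℝ) * (n : ℝ) = ((100 * n : ℕ) : ℝ) := by push_cast; ring
    rw [this, Nat.ceil_natCast]
  rw [hc]
  rcases Nat.lt_or_ge n 2 with h | h
  · have h1 : n = 1 := by omega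
    subst h1
    left
    rw [show 100 * 1 = 99 + 1 by norm_num, Function.iterate_succ_apply']
    exact Toom.RPlusT_one _
  · have : NeZero n := ⟨by omega⟩
    rw [Toom.RPlusT_eq h]
    exact Toom.main S
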